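/- arXiv:0805.1918 — 2 statements merged into one kernel-verified Lean document; each statement's English description precedes it below -/
import Mathlib

section
/- For every g in the complex Grassmann algebra Λ_{2n} and every i with 1 ≤ i ≤ n, the fermionic Fourier transform satisfies the four relations: F^±_{0|2n}(∂_{x`_{2i}} g) = ∓(i/2)·y`_{2i−1}·F^±_{0|2n}(g); F^±_{0|2n}(∂_{x`_{2i−1}} g) = ±(i/2)·y`_{2i}·F^±_{0|2n}(g); F^±_{0|2n}(x`_{2i}·g) = ±2i·∂_{y`_{2i−1}} F^±_{0|2n}(g); and F^±_{0|2n}(x`_{2i−1}·g) = ∓2i·∂_{y`_{2i}} F^±_{0|2n}(g). -/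
open scoped BigOperators
open Finset MeasureTheory

noncomputable section

/-- The Grassmann algebra on `N` anticommuting generators with coefficients in a
commutative ring `R`, represented by its coefficients with respect to the basis of
increasingly-ordered monomials, indexed by subsets of the generators. -/
abbrev Gr (R : Type) (N : ℕ) : Type := Finset (Fin N) → R

namespace Gr

variable {R : Type} [CommRing R] {N : ℕ}

/-- The sign produced when reordering the concatenation of the ordered monomials indexed
by `A` and `B` into the ordered monomial indexed by `A ∪ B`. -/
def msign (A B : Finset (Fin N)) : R :=
  (-1 : R) ^ (((A ×ˢ B).filter fun p => p.2 < p.1).card)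

/-- Multiplication of the Grassmann algebra. -/
def mul (f g : Gr R N) : Gr R N :=
  fun s => ∑ A ∈ s.powerset, msign A (s \ A) * f A * g (s \ A)

/-- The unit of the Grassmann algebra. -/
def one : Gr R N := fun s => if s = (∅ : Finset (Fin N)) then 1 else 0

/-- The `j`-th generator of the Grassmann algebra. -/
def gen (j : Fin N) : Gr R N := fun s => if s = {j} then 1 else 0

/-- Powers in the Grassmann algebra. -/
def pow (f : Gr R N) : ℕ → Gr R N
  | 0 => one
  | k + 1 => mul (pow f k) f

/-- The left partial derivative `∂_j`, i.e. the odd derivation with `∂_j(x_k) = δ_{jk}`. -/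
def pderiv (j : Fin N) (f : Gr R N) : Gr R N :=
  fun s => if j ∈ s then 0
    else (-1 : R) ^ ((s.filter fun i => i < j).card) * f (insert j s)

/-- The exponential of a Grassmann algebra element with nilpotent (zero-constant-term)
argument: the series terminates, and all terms beyond degree `N` vanish. -/
def gexp (f : Gr ℂ N) : Gr ℂ N :=
  ∑ k ∈ Finset.range (N + 1), ((k.factorial : ℂ))⁻¹ • pow f k

/-- Iterated left partial derivatives: the first element of the list acts first. -/
def derivList (l : List (Fin N)) (f : Gr R N) : Gr R N :=
  l.foldl (fun g j => pderiv j g) f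

/-- Complex conjugation of the coefficients. -/
def gconj (f : Gr ℂ N) : Gr ℂ N := fun s => (starRingEnd ℂ) (f s)

end Gr

/-- The Lean index of the paper's generator `x`_{2j-1}` (j = 1,…,n). -/
def lo (n : ℕ) (j : Fin n) : Fin (2 * n) := ⟨2 * (j : ℕ), by have := j.isLt; omega⟩

/-- The Lean index of the paper's generator `x`_{2j}` (j = 1,…,n). -/
def hi (n : ℕ) (j : Fin n) : Fin (2 * n) := ⟨2 * (j : ℕ) + 1, by have := j.isLt; omega⟩

/-- `x`² = Σ_{j=1}^n x`_{2j-1} x`_{2j}`. -/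
def xsq (n : ℕ) : Gr ℂ (2 * n) := ∑ j : Fin n, Gr.mul (Gr.gen (lo n j)) (Gr.gen (hi n j))

/-- The fermionic Laplace operator `Δ_f = 4 Σ_{j=1}^n ∂_{x`_{2j-1}} ∂_{x`_{2j}}`. -/
def lapF (n : ℕ) (f : Gr ℂ (2 * n)) : Gr ℂ (2 * n) :=
  (4 : ℂ) • ∑ j : Fin n, Gr.pderiv (lo n j) (Gr.pderiv (hi n j) f)

/-- The Berezin integral `∫_B = π^{-n} ∂_{x`_{2n}} ⋯ ∂_{x`_1}`. -/
def berezin (n : ℕ) (f : Gr ℂ (2 * n)) : ℂ :=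
  ((Real.pi : ℂ) ^ n)⁻¹ * Gr.derivList (List.finRange (2 * n)) f ∅

/-- The fermionic Gaussian `exp(x`²/2) = Σ_{j=0}^n (x`²)^j/(2^j j!)`. -/
def fermGauss (n : ℕ) : Gr ℂ (2 * n) :=
  ∑ j ∈ Finset.range (n + 1), (((2 : ℂ) ^ j * j.factorial)⁻¹) • Gr.pow (xsq n) j

/-- Embedding of the `x` generators into the Grassmann algebra on the `4n` generators
`x`_1, …, x`_{2n}, y`_1, …, y`_{2n}` (the `x` generators come first). -/
def xi (n : ℕ) (t : Fin (2 * n)) : Fin (2 * n + 2 * n) := Fin.castAdd (2 * n) t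

/-- Embedding of the `y` generators into the Grassmann algebra on the `4n` generators. -/
def yi (n : ℕ) (t : Fin (2 * n)) : Fin (2 * n + 2 * n) := Fin.natAdd (2 * n) t

/-- The algebra embedding `Λ_{2n} → Λ_{4n}` sending the generators to the `x` generators. -/
def embX (n : ℕ) (f : Gr ℂ (2 * n)) : Gr ℂ (2 * n + 2 * n) :=
  fun s => ∑ A : Finset (Fin (2 * n)), if s = A.image (xi n) then f A else 0

/-- The Berezin integral with respect to the `x` variables,
`π^{-n} ∂_{x`_{2n}} ⋯ ∂_{x`_1}`, inside the mixed algebra `Λ_{4n}`. -/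
def berezinX (n : ℕ) (F : Gr ℂ (2 * n + 2 * n)) : Gr ℂ (2 * n + 2 * n) :=
  ((Real.pi : ℂ) ^ n)⁻¹ • Gr.derivList ((List.finRange (2 * n)).map (xi n)) F

/-- The fermionic Fourier kernel
`K^σ(x, y) = exp(-σ (i/2) Σ_{j=1}^n (x`_{2j-1} y`_{2j} - x`_{2j} y`_{2j-1}))`
(for the plus sign `σ = 1`, for the minus sign `σ = -1`). -/
def fermK (n : ℕ) (σ : ℂ) : Gr ℂ (2 * n + 2 * n) :=
  Gr.gexp ((-σ * (Complex.I / 2)) • ∑ j : Fin n,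
    (Gr.mul (Gr.gen (xi n (lo n j))) (Gr.gen (yi n (hi n j))) -
     Gr.mul (Gr.gen (xi n (hi n j))) (Gr.gen (yi n (lo n j)))))

/-- The fermionic Fourier transform
`F^σ_{0|2n}(g)(y) = (2π)^n ∫_{B,x} K^σ(x,y) g(x)`, an element of the Grassmann algebra
in the `y` variables, identified with `Λ_{2n}`. -/
def fermFT (n : ℕ) (σ : ℂ) (g : Gr ℂ (2 * n)) : Gr ℂ (2 * n) :=
  fun s => (((2 * Real.pi : ℝ) : ℂ) ^ n) *
    berezinX n (Gr.mul (fermK n σ) (embX n g)) (s.image (yi n))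


end

noncomputable section

namespace Gr

variable {R : Type} [CommRing R] {N : ℕ}

/-- The sign produced when moving the `j`-th generator to its place in the ordered monomial `s`. -/
def genSign (j : Fin N) (s : Finset (Fin N)) : R :=
  (-1 : R) ^ (s.filter fun i => i < j).card

theorem genSign_mul_self (j : Fin N) (s : Finset (Fin N)) :
    (genSign j s * genSign j s : R) = 1 := by
  rw [genSign, ← mul_pow]; simp

theorem genSign_insert {j k : Fin N} {s : Finset (Fin N)} (hk : k ∉ s) :
    (genSign j (insert k s) : R) = if k < j then -genSign j s else genSign j s := by
  unfold genSign
  rw [Finset.filter_insert]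
  split_ifs with h
  · rw [Finset.card_insert_of_notMem (by simp [hk]), pow_succ]; ring
  · rfl

theorem genSign_erase {j k : Fin N} {s : Finset (Fin N)} (hk : k ∈ s) :
    (genSign j (s.erase k) : R) = if k < j then -genSign j s else genSign j s := by
  conv_rhs => rw [← Finset.insert_erase hk]
  rw [genSign_insert (Finset.notMem_erase k s)]
  split_ifs <;> simp

theorem genSign_image {M : ℕ} {φ : Fin N → Fin M} (hφ : StrictMono φ) (j : Fin N)
    (s : Finset (Fin N)) : (genSign (φ j) (s.image φ) : R) = genSign j s := by
  unfold genSign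
  rw [Finset.filter_image, Finset.card_image_of_injective _ hφ.injective]
  simp only [hφ.lt_iff_lt]

theorem msign_image {M : ℕ} {φ : Fin N → Fin M} (hφ : StrictMono φ)
    (A B : Finset (Fin N)) : (msign (A.image φ) (B.image φ) : R) = msign A B := by
  unfold msign
  rw [← Finset.prodMap_image_product, Finset.filter_image,
    Finset.card_image_of_injective _ (hφ.injective.prodMap hφ.injective)]
  simp only [Prod.map_fst, Prod.map_snd, hφ.lt_iff_lt]

theorem msign_union_left {A B : Finset (Fin N)} (h : Disjoint A B) (C : Finset (Fin N)) :
    (msign (A ∪ B) C : R) = msign A C * msign B C := by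
  unfold msign
  rw [Finset.union_product, Finset.filter_union, Finset.card_union_of_disjoint, pow_add]
  exact Finset.disjoint_filter_filter (Finset.disjoint_product.2 (Or.inl h))

theorem msign_union_right (A : Finset (Fin N)) {B C : Finset (Fin N)} (h : Disjoint B C) :
    (msign A (B ∪ C) : R) = msign A B * msign A C := by
  unfold msign
  rw [Finset.product_union, Finset.filter_union, Finset.card_union_of_disjoint, pow_add]
  exact Finset.disjoint_filter_filter (Finset.disjoint_product.2 (Or.inr h))

/-- Multiplication of the Grassmann algebra as a bilinear map. -/
def mulLin : Gr R N →ₗ[R] Gr R N →ₗ[R] Gr R N :=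
  LinearMap.mk₂ R mul
    (fun f g h => by
      funext s; simp only [mul, Pi.add_apply, mul_add, add_mul, Finset.sum_add_distrib])
    (fun c f g => by
      funext s; simp only [mul, Pi.smul_apply, smul_eq_mul, Finset.mul_sum]
      exact Finset.sum_congr rfl fun _ _ => by ring)
    (fun f g h => by
      funext s; simp only [mul, Pi.add_apply, mul_add, Finset.sum_add_distrib])
    (fun c f g => by
      funext s; simp only [mul, Pi.smul_apply, smul_eq_mul, Finset.mul_sum]
      exact Finset.sum_congr rfl fun _ _ => by ring)

theorem mul_single_single (A B : Finset (Fin N)) (a b : R) :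
    mul (Pi.single A a : Gr R N) (Pi.single B b) =
      if Disjoint A B then Pi.single (A ∪ B) (msign A B * a * b) else 0 := by
  funext s
  have hterm : ∀ C ∈ s.powerset, C ≠ A →
      msign C (s \ C) * (Pi.single A a : Gr R N) C * (Pi.single B b : Gr R N) (s \ C) = 0 := by
    intro C _ hC
    rw [Pi.single_eq_of_ne hC]; ring
  unfold mul
  by_cases hA : A ⊆ s
  · rw [Finset.sum_eq_single_of_mem A (Finset.mem_powerset.2 hA) hterm, Pi.single_eq_same]
    by_cases hB : s \ A = B
    · have hd : Disjoint A B := hB ▸ Finset.disjoint_sdiff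
      have hs : s = A ∪ B := by rw [← hB, Finset.union_sdiff_of_subset hA]
      rw [if_pos hd, hB, Pi.single_eq_same, hs, Pi.single_eq_same]
    · rw [Pi.single_eq_of_ne hB, mul_zero]
      split_ifs with hd
      · rw [Pi.single_eq_of_ne]
        rintro rfl
        exact hB (by rw [Finset.union_sdiff_left, Finset.sdiff_eq_self_of_disjoint hd.symm])
      · rfl
  · rw [Finset.sum_eq_zero fun C hC => hterm C hC ?_]
    · split_ifs with hd
      · rw [Pi.single_eq_of_ne]
        rintro rfl
        exact hA Finset.subset_union_left
      · rfl
    · rintro rfl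
      exact hA (Finset.mem_powerset.1 hC)

theorem single_induction {p : Gr R N → Prop} (hs : ∀ A a, p (Pi.single A a))
    (hadd : ∀ f g, p f → p g → p (f + g)) (f : Gr R N) : p f := by
  classical
  rw [← Finset.univ_sum_single f]
  exact Finset.sum_induction _ p hadd (by simpa using hs ∅ 0) fun A _ => hs A _

theorem add_mul' (f g h : Gr R N) : mul (f + g) h = mul f h + mul g h :=
  LinearMap.map_add₂ mulLin f g h

theorem mul_add' (f g h : Gr R N) : mul f (g + h) = mul f g + mul f h :=
  map_add (mulLin f) g h

theorem zero_mul' (f : Gr R N) : mul 0 f = 0 := LinearMap.map_zero₂ mulLin f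

theorem mul_zero' (f : Gr R N) : mul f 0 = 0 := map_zero (mulLin f)

theorem mul_assoc' (f g h : Gr R N) : mul (mul f g) h = mul f (mul g h) := by
  induction f using single_induction with
  | hadd f₁ f₂ h₁ h₂ => simp only [add_mul', h₁, h₂]
  | hs A a =>
  induction g using single_induction with
  | hadd f₁ f₂ h₁ h₂ => simp only [add_mul', mul_add', h₁, h₂]
  | hs B b =>
  induction h using single_induction with
  | hadd f₁ f₂ h₁ h₂ => simp only [mul_add', h₁, h₂]
  | hs C c =>
  rw [mul_single_single, mul_single_single B C]
  by_cases hAB : Disjoint A B <;> by_cases hBC : Disjoint B C <;>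
    by_cases hAC : Disjoint A C <;>
    simp only [hAB, hBC, hAC, if_true, if_false, mul_single_single, zero_mul', mul_zero',
      Finset.disjoint_union_left, Finset.disjoint_union_right, and_self, and_true, and_false]
  rw [Finset.union_assoc, msign_union_left hAB, msign_union_right A hBC]
  congr 1
  ring

theorem one_eq_single : (one : Gr R N) = Pi.single ∅ 1 := by
  funext s; simp only [one, Pi.single_apply]

theorem gen_eq_single (j : Fin N) : (gen j : Gr R N) = Pi.single {j} 1 := by
  funext s; simp only [gen, Pi.single_apply]

theorem one_mul' (f : Gr R N) : mul one f = f := by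
  rw [one_eq_single]
  induction f using single_induction with
  | hadd f₁ f₂ h₁ h₂ => simp only [mul_add', h₁, h₂]
  | hs A a => simp [mul_single_single, msign]

/-- Left multiplication by a power is the power of the left multiplication. -/
theorem mulLin_pow (f : Gr R N) (k : ℕ) : mulLin (pow f k) = (mulLin f) ^ k := by
  induction k with
  | zero => exact LinearMap.ext one_mul'
  | succ k ih =>
    rw [pow_succ, ← ih]
    refine LinearMap.ext fun g => ?_
    exact mul_assoc' _ _ _

theorem mulLin_mul (f g : Gr R N) :
    mulLin (mul f g) = (mulLin f * mulLin g : Module.End R (Gr R N)) :=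
  LinearMap.ext fun h => mul_assoc' f g h

/-- Left multiplication by the `j`-th generator. -/
def lmul (j : Fin N) : Module.End R (Gr R N) := mulLin (gen j)

/-- The left partial derivative as a linear endomorphism. -/
def pderivLin (j : Fin N) : Module.End R (Gr R N) where
  toFun := pderiv j
  map_add' f g := by
    funext s; simp only [pderiv, Pi.add_apply]; split_ifs <;> ring
  map_smul' c f := by
    funext s; simp only [pderiv, Pi.smul_apply, smul_eq_mul, RingHom.id_apply]
    split_ifs <;> ring

theorem pderivLin_apply (j : Fin N) (f : Gr R N) (s : Finset (Fin N)) :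
    pderivLin j f s = if j ∈ s then 0 else genSign j s * f (insert j s) := rfl

theorem pderivLin_single (j : Fin N) (A : Finset (Fin N)) (a : R) :
    pderivLin j (Pi.single A a : Gr R N) =
      if j ∈ A then Pi.single (A.erase j) (genSign j A * a) else 0 := by
  funext s
  rw [pderivLin_apply]
  by_cases hs : j ∈ s
  · rw [if_pos hs]
    split_ifs
    · rw [Pi.single_eq_of_ne]
      rintro rfl
      simp at hs
    · rfl
  · rw [if_neg hs]
    by_cases hA : insert j s = A
    · subst hA
      simp [hs, genSign_insert hs]
    · rw [Pi.single_eq_of_ne hA, mul_zero]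
      split_ifs with hj
      · rw [Pi.single_eq_of_ne]
        rintro rfl
        exact hA (Finset.insert_erase hj)
      · rfl

theorem lmul_apply (j : Fin N) (f : Gr R N) (s : Finset (Fin N)) :
    lmul j f s = if j ∈ s then genSign j s * f (s.erase j) else 0 := by
  change mul (gen j) f s = _
  unfold mul
  split_ifs with hj
  · rw [Finset.sum_eq_single_of_mem {j} (by simpa using hj)]
    · rw [Finset.sdiff_singleton_eq_erase]
      have : (msign {j} (s.erase j) : R) = genSign j s := by
        rw [← if_neg (c := j < j) (lt_irrefl j) (t := -genSign j s) (e := genSign j s),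
          ← genSign_erase hj, msign, genSign, Finset.singleton_product, Finset.filter_map,
          Finset.card_map]
        rfl
      simp [this, gen]
    · intro C _ hC
      simp [gen, hC]
  · refine Finset.sum_eq_zero fun C hC => ?_
    have : C ≠ {j} := by
      rintro rfl
      exact hj (by simpa using hC)
    simp [gen, this]

theorem end_mul_neg (S T : Module.End R (Gr R N)) : S * -T = -(S * T) := mul_neg S T

theorem end_neg_mul (S T : Module.End R (Gr R N)) : -S * T = -(S * T) := neg_mul S T

theorem pderivLin_mul_pderivLin (j k : Fin N) :
    (pderivLin j * pderivLin k : Module.End R (Gr R N)) = -(pderivLin k * pderivLin j) := by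
  refine LinearMap.ext fun f => funext fun s => ?_
  simp only [Module.End.mul_apply, LinearMap.neg_apply, Pi.neg_apply, pderivLin_apply]
  rcases eq_or_ne j k with rfl | hjk
  · simp
  by_cases hj : j ∈ s
  · simp [hj]
  by_cases hk : k ∈ s
  · simp [hk]
  rw [Finset.insert_comm k j s]
  simp only [Finset.mem_insert, hj, hk, hjk, hjk.symm, or_self, if_false, genSign_insert hj,
    genSign_insert hk]
  rcases lt_or_gt_of_ne hjk with h | h <;> simp only [h, not_lt_of_gt h, if_true, if_false] <;> ring

theorem lmul_mul_lmul (j k : Fin N) :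
    (lmul j * lmul k : Module.End R (Gr R N)) = -(lmul k * lmul j) := by
  refine LinearMap.ext fun f => funext fun s => ?_
  simp only [Module.End.mul_apply, LinearMap.neg_apply, Pi.neg_apply, lmul_apply]
  rcases eq_or_ne j k with rfl | hjk
  · simp
  by_cases hj : j ∈ s
  swap
  · simp [hj]
  by_cases hk : k ∈ s
  swap
  · simp [hk]
  rw [Finset.erase_right_comm (a := j) (b := k)]
  simp only [Finset.mem_erase, hj, hk, hjk, hjk.symm, ne_eq, not_false_eq_true, and_self, if_true,
    genSign_erase hj, genSign_erase hk]
  rcases lt_or_gt_of_ne hjk with h | h <;> simp only [h, not_lt_of_gt h, if_true, if_false] <;> ring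

theorem pderivLin_mul_lmul_self (j : Fin N) :
    (pderivLin j * lmul j : Module.End R (Gr R N)) = 1 - lmul j * pderivLin j := by
  refine LinearMap.ext fun f => funext fun s => ?_
  simp only [Module.End.mul_apply, LinearMap.sub_apply, Pi.sub_apply, pderivLin_apply, lmul_apply,
    Module.End.one_apply]
  by_cases hj : j ∈ s
  · simp [hj, genSign_erase hj, ← mul_assoc, genSign_mul_self]
  · simp [hj, genSign_insert hj, ← mul_assoc, genSign_mul_self]

theorem pderivLin_mul_lmul_of_ne {j k : Fin N} (hjk : j ≠ k) :
    (pderivLin j * lmul k : Module.End R (Gr R N)) = -(lmul k * pderivLin j) := by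
  refine LinearMap.ext fun f => funext fun s => ?_
  simp only [Module.End.mul_apply, LinearMap.neg_apply, Pi.neg_apply, pderivLin_apply, lmul_apply]
  by_cases hj : j ∈ s
  · simp [hj, hjk]
  by_cases hk : k ∈ s
  swap
  · simp [hk, hjk.symm]
  rw [Finset.erase_insert_of_ne hjk]
  simp only [Finset.mem_insert, Finset.mem_erase, hj, hk, hjk.symm, and_false, or_true, if_true,
    if_false, genSign_insert hj, genSign_erase hk]
  rcases lt_or_gt_of_ne hjk with h | h <;> simp only [h, not_lt_of_gt h, if_true, if_false] <;> ring

/-- Graded commutation of a derivative with a generator. -/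
theorem pderivLin_mul_lmul (j k : Fin N) :
    (pderivLin j * lmul k : Module.End R (Gr R N)) =
      (if j = k then 1 else 0) - lmul k * pderivLin j := by
  split_ifs with h
  · subst h; exact pderivLin_mul_lmul_self j
  · rw [pderivLin_mul_lmul_of_ne h, zero_sub]

theorem pderivLin_mul_lmul_mul_lmul (a b c : Fin N) :
    (pderivLin a * (lmul b * lmul c) : Module.End R (Gr R N)) =
      lmul b * lmul c * pderivLin a +
        ((if a = b then lmul c else 0) - (if a = c then lmul b else 0)) := by
  rw [← mul_assoc, pderivLin_mul_lmul, sub_mul, mul_assoc, pderivLin_mul_lmul, mul_sub]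
  split_ifs <;> simp only [one_mul, mul_one, zero_mul, mul_zero, mul_assoc] <;> abel

theorem commute_lmul_mul_lmul (a b c : Fin N) :
    Commute (lmul a : Module.End R (Gr R N)) (lmul b * lmul c) := by
  rw [commute_iff_eq, ← mul_assoc, lmul_mul_lmul a b, end_neg_mul, mul_assoc, lmul_mul_lmul a c,
    end_mul_neg, neg_neg, mul_assoc]

/-- The product of derivatives with the head of the list acting first. -/
def derivListLin (l : List (Fin N)) : Module.End R (Gr R N) :=
  (l.map pderivLin).reverse.prod

theorem derivList_eq (l : List (Fin N)) (f : Gr R N) : derivList l f = derivListLin l f := by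
  induction l generalizing f with
  | nil => rfl
  | cons a l ih =>
    simp only [derivListLin, List.map_cons, List.reverse_cons, List.prod_append,
      List.prod_singleton, Module.End.mul_apply]
    exact ih _

theorem derivListLin_cons (a : Fin N) (l : List (Fin N)) :
    (derivListLin (a :: l) : Module.End R (Gr R N)) = derivListLin l * pderivLin a := by
  simp [derivListLin]

theorem derivListLin_mul_of_anticomm {T : Module.End R (Gr R N)} (l : List (Fin N))
    (h : ∀ a ∈ l, pderivLin a * T = -(T * pderivLin a)) :
    derivListLin l * T = (-1 : R) ^ l.length • (T * derivListLin l) := by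
  induction l with
  | nil => simp [derivListLin]
  | cons a l ih =>
    rw [derivListLin_cons, mul_assoc, h a (by simp), end_mul_neg, ← mul_assoc,
      ih fun b hb => h b (by simp [hb]), List.length_cons, pow_succ, smul_mul_assoc, mul_assoc]
    module

theorem derivListLin_mul_pderivLin_of_mem {j : Fin N} {l : List (Fin N)} (hj : j ∈ l) :
    (derivListLin l * pderivLin j : Module.End R (Gr R N)) = 0 := by
  induction l with
  | nil => simp at hj
  | cons a l ih =>
    rw [derivListLin_cons, mul_assoc]
    rcases List.mem_cons.1 hj with rfl | h
    · have : (pderivLin j * pderivLin j : Module.End R (Gr R N)) = 0 := by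
        refine LinearMap.ext fun f => funext fun s => ?_
        simp [pderivLin_apply]
      rw [this, mul_zero]
    · rw [pderivLin_mul_pderivLin, end_mul_neg, ← mul_assoc, ih h, zero_mul, neg_zero]

/-- Elements all of whose monomials have degree at least `d`. -/
def degreeGE (d : ℕ) : Submodule R (Gr R N) where
  carrier := {f | ∀ s, s.card < d → f s = 0}
  add_mem' hf hg s hs := by simp [hf s hs, hg s hs]
  zero_mem' s _ := rfl
  smul_mem' c f hf s hs := by simp [hf s hs]

theorem lmul_mem_degreeGE (j : Fin N) {d : ℕ} {f : Gr R N} (hf : f ∈ degreeGE (R := R) d) :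
    lmul j f ∈ degreeGE (R := R) (N := N) (d + 1) := by
  intro s hs
  rw [lmul_apply]
  split_ifs with hj
  · rw [hf _ (by rw [Finset.card_erase_of_mem hj]; have := Finset.card_pos.2 ⟨j, hj⟩; omega),
      mul_zero]
  · rfl

theorem pow_eq_zero_of_degreeGE {T : Module.End R (Gr R N)}
    (hT : ∀ d, ∀ f ∈ degreeGE (R := R) (N := N) d, T f ∈ degreeGE (R := R) (N := N) (d + 2))
    (hN : 0 < N) : T ^ N = 0 := by
  have key : ∀ (k : ℕ) (f : Gr R N), (T ^ k) f ∈ degreeGE (R := R) (N := N) (2 * k) := by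
    intro k f
    induction k with
    | zero => intro s hs; omega
    | succ k ih => rw [pow_succ']; exact hT _ _ ih
  refine LinearMap.ext fun f => funext fun s => key N f s ?_
  have := Finset.card_le_univ s
  rw [Fintype.card_fin] at this
  omega

end Gr

/-- A truncated exponential of a nilpotent element satisfies the differential equation
`[d, exp E] = exp E * [d, E]` when `[d, E]` commutes with `E`. -/
theorem mul_sum_inv_factorial_smul_pow {A : Type*} [Ring A] [Algebra ℂ A] {d E w : A} {N : ℕ}
    (hd : d * E = E * d + w) (hw : Commute w E) (hE : E ^ N = 0) :
    d * (∑ k ∈ Finset.range (N + 1), ((k.factorial : ℂ))⁻¹ • E ^ k) =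
      (∑ k ∈ Finset.range (N + 1), ((k.factorial : ℂ))⁻¹ • E ^ k) * (d + w) := by
  have hpow : ∀ k : ℕ, d * E ^ (k + 1) = E ^ (k + 1) * d + ((k + 1 : ℕ) : ℂ) • (E ^ k * w) := by
    intro k
    induction k with
    | zero => simp [hd]
    | succ k ih =>
      rw [pow_succ, ← mul_assoc, ih, add_mul, mul_assoc, hd, smul_mul_assoc, mul_assoc, hw.eq,
        mul_add, ← mul_assoc, ← mul_assoc, ← pow_succ, ← pow_succ]
      push_cast
      module
  have hfac : ∀ k : ℕ, (((k + 1).factorial : ℂ))⁻¹ * ((k + 1 : ℕ) : ℂ) = ((k.factorial : ℂ))⁻¹ := by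
    intro k
    have h₁ : (k.factorial : ℂ) ≠ 0 := by exact_mod_cast k.factorial_ne_zero
    have h₂ : ((k + 1 : ℕ) : ℂ) ≠ 0 := by exact_mod_cast k.succ_ne_zero
    rw [Nat.factorial_succ, Nat.cast_mul]
    field_simp
  have hw' : (∑ k ∈ Finset.range (N + 1), ((k.factorial : ℂ))⁻¹ • E ^ k) * w =
      ∑ k ∈ Finset.range N, ((k.factorial : ℂ))⁻¹ • (E ^ k * w) := by
    rw [Finset.sum_range_succ, hE, smul_zero, add_zero, Finset.sum_mul]
    exact Finset.sum_congr rfl fun k _ => smul_mul_assoc _ _ _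
  rw [mul_add, hw', Finset.sum_range_succ', mul_add, add_mul, Finset.mul_sum, Finset.sum_mul]
  simp only [mul_smul_comm, smul_mul_assoc, hpow, smul_add, smul_smul, hfac,
    Finset.sum_add_distrib, pow_zero, mul_one, one_mul]
  abel

namespace Gr

section Embedding

variable {n : ℕ}

theorem strictMono_xi : StrictMono (xi n) := Fin.strictMono_castAdd _

theorem strictMono_yi : StrictMono (yi n) := Fin.strictMono_natAdd _

theorem xi_ne_yi (a b : Fin (2 * n)) : xi n a ≠ yi n b := by
  intro h
  have := congrArg Fin.val h
  simp only [xi, yi, Fin.val_castAdd, Fin.val_natAdd] at this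
  omega

/-- The embedding `embX` as a linear map. -/
def embXLin (n : ℕ) : Gr ℂ (2 * n) →ₗ[ℂ] Gr ℂ (2 * n + 2 * n) where
  toFun := embX n
  map_add' f g := by
    funext s
    simp only [embX, Pi.add_apply, ← Finset.sum_add_distrib]
    exact Finset.sum_congr rfl fun A _ => by split_ifs <;> simp
  map_smul' c f := by
    funext s
    simp only [embX, Pi.smul_apply, smul_eq_mul, Finset.mul_sum, RingHom.id_apply]
    exact Finset.sum_congr rfl fun A _ => by split_ifs <;> simp

theorem embX_single (A : Finset (Fin (2 * n))) (a : ℂ) :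
    embX n (Pi.single A a) = Pi.single (A.image (xi n)) a := by
  funext s
  rw [embX, Finset.sum_eq_single A]
  · simp only [Pi.single_eq_same, Pi.single_apply]
  · intro B _ hB
    simp [hB]
  · simp

theorem embX_add (f g : Gr ℂ (2 * n)) : embX n (f + g) = embX n f + embX n g :=
  map_add (embXLin n) f g

theorem embX_mul (f g : Gr ℂ (2 * n)) : embX n (mul f g) = mul (embX n f) (embX n g) := by
  induction f using single_induction with
  | hadd f₁ f₂ h₁ h₂ => simp only [add_mul', embX_add, h₁, h₂]
  | hs A a =>
  induction g using single_induction with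
  | hadd f₁ f₂ h₁ h₂ => simp only [mul_add', embX_add, h₁, h₂]
  | hs B b =>
  simp only [embX_single, mul_single_single, msign_image strictMono_xi,
    Finset.disjoint_image strictMono_xi.injective, ← Finset.image_union]
  split_ifs
  · exact embX_single _ _
  · exact map_zero (embXLin n)

theorem embX_gen (j : Fin (2 * n)) : embX n (gen j) = gen (xi n j) := by
  rw [gen_eq_single, gen_eq_single, embX_single, Finset.image_singleton]

theorem embX_pderiv (j : Fin (2 * n)) (f : Gr ℂ (2 * n)) :
    embX n (pderivLin j f) = pderivLin (xi n j) (embX n f) := by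
  induction f using single_induction with
  | hadd f₁ f₂ h₁ h₂ => simp only [map_add, embX_add, h₁, h₂]
  | hs A a =>
  simp only [embX_single, pderivLin_single, genSign_image strictMono_xi,
    strictMono_xi.injective.mem_finset_image, ← Finset.image_erase strictMono_xi.injective]
  split_ifs
  · exact embX_single _ _
  · exact map_zero (embXLin n)

theorem pderivLin_yi_embX (j : Fin (2 * n)) (f : Gr ℂ (2 * n)) :
    pderivLin (yi n j) (embX n f) = 0 := by
  induction f using single_induction with
  | hadd f₁ f₂ h₁ h₂ => simp only [map_add, embX_add, h₁, h₂, add_zero]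
  | hs A a =>
  rw [embX_single, pderivLin_single, if_neg]
  simp [xi_ne_yi]

/-- Extraction of the component involving only the `y` generators. -/
def restrictY (n : ℕ) : Gr ℂ (2 * n + 2 * n) →ₗ[ℂ] Gr ℂ (2 * n) where
  toFun F s := F (s.image (yi n))
  map_add' _ _ := rfl
  map_smul' _ _ := rfl

theorem restrictY_apply (F : Gr ℂ (2 * n + 2 * n)) (s : Finset (Fin (2 * n))) :
    restrictY n F s = F (s.image (yi n)) := rfl

theorem restrictY_pderivLin (j : Fin (2 * n)) (F : Gr ℂ (2 * n + 2 * n)) :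
    restrictY n (pderivLin (yi n j) F) = pderivLin j (restrictY n F) := by
  funext s
  simp only [restrictY_apply, pderivLin_apply, genSign_image strictMono_yi,
    strictMono_yi.injective.mem_finset_image, Finset.image_insert]

theorem restrictY_lmul (j : Fin (2 * n)) (F : Gr ℂ (2 * n + 2 * n)) :
    restrictY n (lmul (yi n j) F) = lmul j (restrictY n F) := by
  funext s
  simp only [restrictY_apply, lmul_apply, genSign_image strictMono_yi,
    strictMono_yi.injective.mem_finset_image, Finset.image_erase strictMono_yi.injective]

/-- The product of all derivatives with respect to the `x` generators. -/
def derivX (n : ℕ) : Module.End ℂ (Gr ℂ (2 * n + 2 * n)) :=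
  derivListLin ((List.finRange (2 * n)).map (xi n))

theorem derivX_mul_pderivLin_xi (j : Fin (2 * n)) : derivX n * pderivLin (xi n j) = 0 :=
  derivListLin_mul_pderivLin_of_mem (List.mem_map_of_mem (List.mem_finRange j))

theorem derivX_mul_of_anticomm {T : Module.End ℂ (Gr ℂ (2 * n + 2 * n))}
    (h : ∀ j, pderivLin (xi n j) * T = -(T * pderivLin (xi n j))) :
    derivX n * T = T * derivX n := by
  rw [derivX, derivListLin_mul_of_anticomm]
  · simp
  · intro a ha
    obtain ⟨j, _, rfl⟩ := List.mem_map.1 ha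
    exact h j

theorem derivX_mul_pderivLin_yi (j : Fin (2 * n)) :
    derivX n * pderivLin (yi n j) = pderivLin (yi n j) * derivX n :=
  derivX_mul_of_anticomm fun _ => pderivLin_mul_pderivLin _ _

theorem derivX_mul_lmul_yi (j : Fin (2 * n)) :
    derivX n * lmul (yi n j) = lmul (yi n j) * derivX n :=
  derivX_mul_of_anticomm fun _ => pderivLin_mul_lmul_of_ne (xi_ne_yi _ _)

/-- Left multiplication by the exponent of the Fourier kernel. -/
def kerExp (n : ℕ) (c : ℂ) : Module.End ℂ (Gr ℂ (2 * n + 2 * n)) :=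
  c • ∑ j : Fin n, (lmul (xi n (lo n j)) * lmul (yi n (hi n j)) -
    lmul (xi n (hi n j)) * lmul (yi n (lo n j)))

/-- Left multiplication by the Fourier kernel. -/
def kerLin (n : ℕ) (c : ℂ) : Module.End ℂ (Gr ℂ (2 * n + 2 * n)) :=
  ∑ k ∈ Finset.range (2 * n + 2 * n + 1), ((k.factorial : ℂ))⁻¹ • kerExp n c ^ k

theorem mulLin_fermK (σ : ℂ) : mulLin (fermK n σ) = kerLin n (-σ * (Complex.I / 2)) := by
  simp only [fermK, gexp, map_sum, map_smul, mulLin_pow, kerLin, kerExp, map_sub, mulLin_mul, lmul]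

theorem commute_lmul_kerExp (a : Fin (2 * n + 2 * n)) (c : ℂ) :
    Commute (lmul a) (kerExp n c) :=
  (Commute.sum_right _ _ _ fun _ _ =>
    (commute_lmul_mul_lmul _ _ _).sub_right (commute_lmul_mul_lmul _ _ _)).smul_right c

theorem kerExp_pow_eq_zero (hn : 0 < n) (c : ℂ) : kerExp n c ^ (2 * n + 2 * n) = 0 := by
  refine pow_eq_zero_of_degreeGE (fun d f hf => ?_) (by omega)
  simp only [kerExp, LinearMap.smul_apply, LinearMap.sum_apply, LinearMap.sub_apply,
    Module.End.mul_apply]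
  exact Submodule.smul_mem _ _ (Submodule.sum_mem _ fun j _ => Submodule.sub_mem _
    (lmul_mem_degreeGE _ (lmul_mem_degreeGE _ hf)) (lmul_mem_degreeGE _ (lmul_mem_degreeGE _ hf)))

theorem pderivLin_mul_kerExp (a : Fin (2 * n + 2 * n)) (c : ℂ) :
    pderivLin a * kerExp n c = kerExp n c * pderivLin a + c • ∑ j : Fin n,
      (((if a = xi n (lo n j) then lmul (yi n (hi n j)) else 0) -
        (if a = yi n (hi n j) then lmul (xi n (lo n j)) else 0)) -
      ((if a = xi n (hi n j) then lmul (yi n (lo n j)) else 0) -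
        (if a = yi n (lo n j) then lmul (xi n (hi n j)) else 0))) := by
  simp only [kerExp, mul_smul_comm, smul_mul_assoc, Finset.mul_sum, Finset.sum_mul, mul_sub,
    sub_mul, pderivLin_mul_lmul_mul_lmul, ← smul_add, ← Finset.sum_add_distrib]
  congr 1
  exact Finset.sum_congr rfl fun j _ => by abel

theorem lo_inj {i j : Fin n} : lo n i = lo n j ↔ i = j := by
  simp only [lo, Fin.ext_iff]; omega

theorem hi_inj {i j : Fin n} : hi n i = hi n j ↔ i = j := by
  simp only [hi, Fin.ext_iff]; omega

theorem lo_ne_hi (i j : Fin n) : lo n i ≠ hi n j := by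
  simp only [lo, hi, ne_eq, Fin.ext_iff]; omega

theorem pderivLin_mul_kerLin {a : Fin (2 * n + 2 * n)} {c r : ℂ} {b : Fin (2 * n + 2 * n)}
    (hn : 0 < n) (h : pderivLin a * kerExp n c = kerExp n c * pderivLin a + r • lmul b) :
    pderivLin a * kerLin n c = kerLin n c * (pderivLin a + r • lmul b) :=
  mul_sum_inv_factorial_smul_pow h ((commute_lmul_kerExp b c).smul_left r)
    (kerExp_pow_eq_zero hn c)

theorem pderivLin_xi_hi_mul_kerLin (i : Fin n) (c : ℂ) :
    pderivLin (xi n (hi n i)) * kerLin n c =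
      kerLin n c * (pderivLin (xi n (hi n i)) + (-c) • lmul (yi n (lo n i))) := by
  refine pderivLin_mul_kerLin i.pos ?_
  rw [pderivLin_mul_kerExp]
  simp [strictMono_xi.injective.eq_iff, hi_inj, (lo_ne_hi _ _).symm, xi_ne_yi]
  exact (neg_smul _ _).symm

theorem pderivLin_xi_lo_mul_kerLin (i : Fin n) (c : ℂ) :
    pderivLin (xi n (lo n i)) * kerLin n c =
      kerLin n c * (pderivLin (xi n (lo n i)) + c • lmul (yi n (hi n i))) := by
  refine pderivLin_mul_kerLin i.pos ?_
  rw [pderivLin_mul_kerExp]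
  simp [strictMono_xi.injective.eq_iff, lo_inj, lo_ne_hi, xi_ne_yi]

theorem pderivLin_yi_hi_mul_kerLin (i : Fin n) (c : ℂ) :
    pderivLin (yi n (hi n i)) * kerLin n c =
      kerLin n c * (pderivLin (yi n (hi n i)) + (-c) • lmul (xi n (lo n i))) := by
  refine pderivLin_mul_kerLin i.pos ?_
  rw [pderivLin_mul_kerExp]
  simp [strictMono_yi.injective.eq_iff, hi_inj, (lo_ne_hi _ _).symm, (xi_ne_yi _ _).symm]
  exact (neg_smul _ _).symm

theorem pderivLin_yi_lo_mul_kerLin (i : Fin n) (c : ℂ) :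
    pderivLin (yi n (lo n i)) * kerLin n c =
      kerLin n c * (pderivLin (yi n (lo n i)) + c • lmul (xi n (hi n i))) := by
  refine pderivLin_mul_kerLin i.pos ?_
  rw [pderivLin_mul_kerExp]
  simp [strictMono_yi.injective.eq_iff, lo_inj, lo_ne_hi, (xi_ne_yi _ _).symm]

theorem commute_lmul_kerLin (a : Fin (2 * n + 2 * n)) (c : ℂ) :
    Commute (lmul a) (kerLin n c) :=
  Commute.sum_right _ _ _ fun _ _ => ((commute_lmul_kerExp a c).pow_right _).smul_right _

theorem fermFT_eq (σ : ℂ) (g : Gr ℂ (2 * n)) :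
    fermFT n σ g = ((((2 * Real.pi : ℝ) : ℂ) ^ n) * ((Real.pi : ℂ) ^ n)⁻¹) •
      restrictY n ((derivX n * kerLin n (-σ * (Complex.I / 2))) (embX n g)) := by
  funext s
  rw [← mulLin_fermK, fermFT, berezinX, derivList_eq]
  simp only [Pi.smul_apply, smul_eq_mul, ← mul_assoc]
  rfl

/-- Integration by parts. -/
theorem restrictY_derivX_kerLin_pderiv {a b : Fin (2 * n)} {c r : ℂ}
    (h : pderivLin (xi n a) * kerLin n c =
      kerLin n c * (pderivLin (xi n a) + r • lmul (yi n b))) (g : Gr ℂ (2 * n)) :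
    restrictY n ((derivX n * kerLin n c) (embX n (pderivLin a g))) =
      (-r) • lmul b (restrictY n ((derivX n * kerLin n c) (embX n g))) := by
  have key : derivX n * kerLin n c * pderivLin (xi n a) =
      (-r) • (lmul (yi n b) * (derivX n * kerLin n c)) := by
    have h₀ : derivX n * (pderivLin (xi n a) * kerLin n c) = 0 := by
      rw [← mul_assoc, derivX_mul_pderivLin_xi, zero_mul]
    rw [h, mul_add, mul_add, mul_smul_comm, mul_smul_comm,
      ← (commute_lmul_kerLin (yi n b) c).eq, ← mul_assoc, ← mul_assoc,
      derivX_mul_lmul_yi, mul_assoc (lmul _)] at h₀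
    exact (eq_neg_of_add_eq_zero_left h₀).trans (neg_smul _ _).symm
  rw [embX_pderiv, ← Module.End.mul_apply, key, LinearMap.smul_apply, map_smul,
    Module.End.mul_apply, restrictY_lmul]

/-- Differentiation under the integral sign. -/
theorem restrictY_derivX_kerLin_lmul {a b : Fin (2 * n)} {c r : ℂ}
    (h : pderivLin (yi n a) * kerLin n c =
      kerLin n c * (pderivLin (yi n a) + r • lmul (xi n b))) (g : Gr ℂ (2 * n)) :
    pderivLin a (restrictY n ((derivX n * kerLin n c) (embX n g))) =
      r • restrictY n ((derivX n * kerLin n c) (embX n (lmul b g))) := by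
  have hb : embX n (lmul b g) = lmul (xi n b) (embX n g) := by
    change embX n (mul (gen b) g) = mul (gen (xi n b)) (embX n g)
    rw [embX_mul, embX_gen]
  rw [← restrictY_pderivLin, ← Module.End.mul_apply (pderivLin _), ← mul_assoc,
    ← derivX_mul_pderivLin_yi, mul_assoc, h, hb]
  simp only [Module.End.mul_apply, LinearMap.add_apply, LinearMap.smul_apply, pderivLin_yi_embX,
    zero_add, map_smul]

theorem fermFT_pderiv {σ : ℂ} {a b : Fin (2 * n)} {r : ℂ}
    (h : pderivLin (xi n a) * kerLin n (-σ * (Complex.I / 2)) =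
      kerLin n (-σ * (Complex.I / 2)) * (pderivLin (xi n a) + r • lmul (yi n b)))
    (g : Gr ℂ (2 * n)) :
    fermFT n σ (pderiv a g) = (-r) • mul (gen b) (fermFT n σ g) := by
  change fermFT n σ (pderivLin a g) = (-r) • lmul b (fermFT n σ g)
  rw [fermFT_eq, fermFT_eq, restrictY_derivX_kerLin_pderiv h, map_smul, smul_comm]

theorem fermFT_gen_mul {σ : ℂ} {a b : Fin (2 * n)} {r : ℂ} (hr : r ≠ 0)
    (h : pderivLin (yi n a) * kerLin n (-σ * (Complex.I / 2)) =
      kerLin n (-σ * (Complex.I / 2)) * (pderivLin (yi n a) + r • lmul (xi n b)))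
    (g : Gr ℂ (2 * n)) :
    fermFT n σ (mul (gen b) g) = r⁻¹ • pderiv a (fermFT n σ g) := by
  change fermFT n σ (lmul b g) = r⁻¹ • pderivLin a (fermFT n σ g)
  rw [fermFT_eq, fermFT_eq, map_smul, restrictY_derivX_kerLin_lmul h, smul_comm _ r,
    inv_smul_smul₀ hr]

end Embedding

end Gr

end

/-- For every `g ∈ Λ_{2n}` and every `i` with `1 ≤ i ≤ n` (here `i : Fin n`, with the
paper's generator `x`_{2i-1}` being `lo n i` and `x`_{2i}` being `hi n i`), the fermionic
Fourier transform `F^±_{0|2n}` (sign `σ = ±1`) satisfies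
`F^±(∂_{x`_{2i}} g) = ∓(i/2) y`_{2i-1} F^±(g)`,
`F^±(∂_{x`_{2i-1}} g) = ±(i/2) y`_{2i} F^±(g)`,
`F^±(x`_{2i} g) = ±2i ∂_{y`_{2i-1}} F^±(g)` and
`F^±(x`_{2i-1} g) = ∓2i ∂_{y`_{2i}} F^±(g)`. -/
theorem fermFT_calculus_rules (n : ℕ) (σ : ℂ) (hσ : σ = 1 ∨ σ = -1)
    (g : Gr ℂ (2 * n)) (i : Fin n) :
    fermFT n σ (Gr.pderiv (hi n i) g) =
      (-σ * (Complex.I / 2)) • Gr.mul (Gr.gen (lo n i)) (fermFT n σ g) ∧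
    fermFT n σ (Gr.pderiv (lo n i) g) =
      (σ * (Complex.I / 2)) • Gr.mul (Gr.gen (hi n i)) (fermFT n σ g) ∧
    fermFT n σ (Gr.mul (Gr.gen (hi n i)) g) =
      (σ * (2 * Complex.I)) • Gr.pderiv (lo n i) (fermFT n σ g) ∧
    fermFT n σ (Gr.mul (Gr.gen (lo n i)) g) =
      (-σ * (2 * Complex.I)) • Gr.pderiv (hi n i) (fermFT n σ g) := by
  have hσ0 : σ * σ = 1 := by rcases hσ with rfl | rfl <;> norm_num
  have hc : (-σ * (Complex.I / 2)) * (σ * (2 * Complex.I)) = 1 := by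
    linear_combination (-Complex.I ^ 2) * hσ0 - Complex.I_sq
  have hc0 : -σ * (Complex.I / 2) ≠ 0 := left_ne_zero_of_mul_eq_one hc
  refine ⟨?_, ?_, ?_, ?_⟩
  · rw [Gr.fermFT_pderiv (Gr.pderivLin_xi_hi_mul_kerLin i _), neg_neg]
  · rw [Gr.fermFT_pderiv (Gr.pderivLin_xi_lo_mul_kerLin i _), neg_mul, neg_neg]
  · rw [Gr.fermFT_gen_mul hc0 (Gr.pderivLin_yi_lo_mul_kerLin i _), inv_eq_of_mul_eq_one_right hc]
  · rw [Gr.fermFT_gen_mul (neg_ne_zero.2 hc0) (Gr.pderivLin_yi_hi_mul_kerLin i _), inv_neg,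
      inv_eq_of_mul_eq_one_right hc, neg_mul σ]
end

section
/- For every integer k with 0 ≤ k ≤ n one has F^±_{0|2n}(x`^{2k}) = 2^{2k−n} · (k!/(n−k)!) · y`^{2n−2k}, where x`^{2k} denotes the k-th power of x`² = Σ_{j=1}^n x`_{2j−1} x`_{2j} and y`^{2n−2k} the (n−k)-th power of y`² = Σ_{j=1}^n y`_{2j−1} y`_{2j}. -/
open scoped BigOperators
open Finset MeasureTheory

namespace Gr

variable {R : Type} [CommRing R] {N : ℕ}

/-- The ordered monomial indexed by `A`. -/
def monomial (A : Finset (Fin N)) : Gr R N := fun s => if s = A then 1 else 0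

theorem mul_sum_smul {ι κ : Type*} (U : Finset ι) (V : Finset κ) (a : ι → R) (b : κ → R)
    (f : ι → Gr R N) (g : κ → Gr R N) :
    mul (∑ i ∈ U, a i • f i) (∑ j ∈ V, b j • g j) =
      ∑ i ∈ U, ∑ j ∈ V, (a i * b j) • mul (f i) (g j) := by
  funext s
  simp only [mul, Finset.sum_apply, Pi.smul_apply, smul_eq_mul, Finset.mul_sum, Finset.sum_mul]
  refine Finset.sum_comm.trans (Eq.trans ?_ Finset.sum_comm)
  refine Finset.sum_congr rfl fun j _ => Finset.sum_comm.trans ?_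
  exact Finset.sum_congr rfl fun i _ => Finset.sum_congr rfl fun A _ => by ring

theorem mul_monomial (A B : Finset (Fin N)) :
    mul (monomial A : Gr R N) (monomial B) =
      if Disjoint A B then (msign A B : R) • monomial (A ∪ B) else 0 := by
  funext s
  have key : ∀ C ∈ s.powerset, (msign C (s \ C) : R) * (monomial A : Gr R N) C *
      (monomial B : Gr R N) (s \ C) =
      if C = A then (if s \ A = B then (msign A B : R) else 0) else 0 := by
    intro C _
    simp only [monomial]
    split_ifs <;> simp_all
  rw [mul, Finset.sum_congr rfl key, Finset.sum_ite_eq']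
  simp only [Finset.mem_powerset]
  by_cases hd : Disjoint A B
  · rw [if_pos hd]
    have : (A ⊆ s ∧ s \ A = B) ↔ s = A ∪ B := by
      constructor
      · rintro ⟨h1, rfl⟩
        exact (Finset.union_sdiff_of_subset h1).symm
      · rintro rfl
        exact ⟨Finset.subset_union_left, by
          rw [Finset.union_sdiff_left, Finset.sdiff_eq_self_of_disjoint hd.symm]⟩
    simp only [Pi.smul_apply, monomial, smul_eq_mul, mul_ite, mul_one, mul_zero]
    simp only [← this, ite_and]
  · rw [if_neg hd]
    split_ifs with h1 h2
    · exact absurd (h2 ▸ Finset.disjoint_sdiff) hd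
    all_goals rfl

theorem msign_eq_prod (A B : Finset (Fin N)) :
    (msign A B : R) = ∏ a ∈ A, ∏ b ∈ B, if b < a then -1 else 1 := by
  rw [msign, ← Finset.prod_product', Finset.prod_ite]
  simp

theorem gen_mul_gen {a b : Fin N} (h : a < b) :
    mul (gen a : Gr R N) (gen b) = monomial {a, b} := by
  have hg : ∀ j : Fin N, (gen j : Gr R N) = monomial {j} := fun _ => rfl
  rw [hg, hg, mul_monomial, if_pos (by simpa using h.ne), msign_eq_prod]
  simp [h.not_gt]

theorem derivList_apply (l : List (Fin N)) (hl : l.Pairwise (· < ·)) (f : Gr R N)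
    (s : Finset (Fin N)) (hs : ∀ i ∈ l, ∀ j ∈ s, i < j) :
    derivList l f s = f (l.toFinset ∪ s) := by
  induction l generalizing f with
  | nil => simp [derivList]
  | cons j l ih =>
    rw [List.pairwise_cons] at hl
    have hlt : ∀ i ∈ l.toFinset ∪ s, j < i := by
      intro i hi
      rcases Finset.mem_union.1 hi with hi | hi
      · exact hl.1 i (List.mem_toFinset.1 hi)
      · exact hs j List.mem_cons_self i hi
    change derivList l (pderiv j f) s = _
    rw [ih hl.2 _ fun i hi => hs i (List.mem_cons_of_mem _ hi), pderiv,
      if_neg fun h => lt_irrefl _ (hlt j h),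
      Finset.filter_false_of_mem fun i hi => (hlt i hi).not_gt]
    simp [Finset.insert_union]

/-- Powers of a linear combination of monomials with pairwise disjoint supports, where `g`
collects the coefficients and reordering signs. -/
theorem pow_sum_monomial {ι : Type} [Fintype ι] [DecidableEq ι] (P : ι → Finset (Fin N))
    (hne : ∀ t, (P t).Nonempty) (hP : ∀ t u, t ≠ u → Disjoint (P t) (P u)) (w : ι → R)
    (g : Finset ι → R) (hg0 : g ∅ = 1)
    (hg : ∀ t (U : Finset ι), t ∉ U → g (insert t U) = g U * w t * msign (U.biUnion P) (P t))
    (m : ℕ) :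
    pow (∑ t, w t • (monomial (P t) : Gr R N)) m =
      ∑ U ∈ Finset.powersetCard m Finset.univ,
        ((m.factorial : R) * g U) • monomial (U.biUnion P) := by
  induction m with
  | zero =>
    simp [pow, hg0]
    rfl
  | succ m ih =>
    have hd : ∀ (U : Finset ι) t, Disjoint (U.biUnion P) (P t) ↔ t ∉ U := by
      intro U t
      rw [Finset.disjoint_biUnion_left]
      constructor
      · intro h ht
        exact (hne t).ne_empty (disjoint_self.1 (h t ht))
      · intro ht u hu
        exact hP u t fun h => ht (h ▸ hu)
    rw [pow, ih, mul_sum_smul]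
    have key : ∀ U ∈ Finset.powersetCard m (Finset.univ : Finset ι),
        ∑ t, ((m.factorial : R) * g U * w t) •
          mul (monomial (U.biUnion P) : Gr R N) (monomial (P t)) =
        ∑ t ∈ Uᶜ, ((m.factorial : R) * g (insert t U)) •
          (monomial ((insert t U).biUnion P) : Gr R N) := by
      intro U _
      symm
      rw [← Finset.sum_subset (Finset.subset_univ Uᶜ)]
      · refine Finset.sum_congr rfl fun t ht => ?_
        have ht' : t ∉ U := Finset.mem_compl.1 ht
        rw [mul_monomial, if_pos ((hd U t).2 ht'), hg t U ht', Finset.biUnion_insert,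
          Finset.union_comm, smul_smul]
        congr 1
        ring
      · intro t _ ht
        rw [mul_monomial, if_neg fun h => ht (Finset.mem_compl.2 ((hd U t).1 h)), smul_zero]
    rw [Finset.sum_congr rfl key]
    have key2 : ∀ V ∈ Finset.powersetCard (m + 1) (Finset.univ : Finset ι),
        (((m + 1).factorial : R) * g V) • (monomial (V.biUnion P) : Gr R N) =
        ∑ _t ∈ V, ((m.factorial : R) * g V) • (monomial (V.biUnion P) : Gr R N) := by
      intro V hV
      rw [Finset.sum_const, (Finset.mem_powersetCard.1 hV).2, Nat.factorial_succ,
        ← Nat.cast_smul_eq_nsmul R, smul_smul]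
      push_cast
      congr 1
      ring
    rw [Finset.sum_congr rfl key2, Finset.sum_sigma', Finset.sum_sigma']
    refine Finset.sum_bij' (fun x _ => ⟨insert x.2 x.1, x.2⟩) (fun y _ => ⟨y.1.erase y.2, y.2⟩)
      ?_ ?_ ?_ ?_ ?_
    · rintro ⟨U, t⟩ h
      simp only [Finset.mem_sigma, Finset.mem_powersetCard, Finset.mem_compl] at h ⊢
      refine ⟨⟨Finset.subset_univ _, ?_⟩, Finset.mem_insert_self _ _⟩
      rw [Finset.card_insert_of_notMem h.2, h.1.2]
    · rintro ⟨V, t⟩ h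
      simp only [Finset.mem_sigma, Finset.mem_powersetCard, Finset.mem_compl] at h ⊢
      refine ⟨⟨Finset.subset_univ _, ?_⟩, Finset.notMem_erase _ _⟩
      rw [Finset.card_erase_of_mem h.2, h.1.2, Nat.add_sub_cancel]
    · rintro ⟨U, t⟩ h
      simp only [Finset.mem_sigma, Finset.mem_compl] at h
      simp [Finset.erase_insert h.2]
    · rintro ⟨V, t⟩ h
      simp only [Finset.mem_sigma] at h
      simp [Finset.insert_erase h.2]
    · rintro ⟨U, t⟩ h
      rfl

theorem msign_biUnion_left {ι : Type*} [DecidableEq ι] (P : ι → Finset (Fin N)) (U : Finset ι)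
    (hP : ∀ t u, t ≠ u → Disjoint (P t) (P u)) (B : Finset (Fin N)) :
    (msign (U.biUnion P) B : R) = ∏ u ∈ U, msign (P u) B := by
  simp only [msign_eq_prod]
  rw [Finset.prod_biUnion fun t _ u _ h => hP t u h]

theorem msign_biUnion_right {ι : Type*} [DecidableEq ι] (P : ι → Finset (Fin N)) (U : Finset ι)
    (hP : ∀ t u, t ≠ u → Disjoint (P t) (P u)) (A : Finset (Fin N)) :
    (msign A (U.biUnion P) : R) = ∏ u ∈ U, msign A (P u) := by
  simp only [msign_eq_prod]
  rw [Finset.prod_comm, Finset.prod_biUnion fun t _ u _ h => hP t u h]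
  exact Finset.prod_congr rfl fun _ _ => Finset.prod_comm

theorem msign_pair_pair {a b c d : Fin N} (hab : a ≠ b) (hcd : c ≠ d) :
    (msign {a, b} {c, d} : R) =
      ((if c < a then -1 else 1) * (if d < a then -1 else 1)) *
        ((if c < b then -1 else 1) * (if d < b then -1 else 1)) := by
  rw [msign_eq_prod, Finset.prod_pair hab, Finset.prod_pair hcd, Finset.prod_pair hcd]

end Gr

/-- The support of the `j`-th summand of `xsq`. -/
def loHi (n : ℕ) (j : Fin n) : Finset (Fin (2 * n)) := {lo n j, hi n j}

/-- The supports of the summands of the exponent of the Fourier kernel. -/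
def kerPair (n : ℕ) : Fin n ⊕ Fin n → Finset (Fin (2 * n + 2 * n))
  | .inl j => {xi n (lo n j), yi n (hi n j)}
  | .inr j => {xi n (hi n j), yi n (lo n j)}

/-- The coefficients of the exponential of the exponent of the Fourier kernel. -/
def kerCoeff {n : ℕ} (c : ℂ) (U : Finset (Fin n ⊕ Fin n)) : ℂ :=
  c ^ U.card * (-1) ^ U.toRight.card * (-1) ^ U.card.choose 2 *
    (-1) ^ (U.toLeft ∩ U.toRight).card

theorem loHi_disjoint (n : ℕ) (i j : Fin n) (h : i ≠ j) : Disjoint (loHi n i) (loHi n j) := by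
  have : (i : ℕ) ≠ j := fun h' => h (Fin.ext h')
  simp [loHi, lo, hi, Fin.ext_iff]
  omega

theorem kerPair_disjoint (n : ℕ) (t u : Fin n ⊕ Fin n) (h : t ≠ u) :
    Disjoint (kerPair n t) (kerPair n u) := by
  rcases t with i | i <;> rcases u with j | j <;>
    simp [kerPair, lo, hi, xi, yi, Fin.ext_iff] at h ⊢ <;> omega

theorem msign_kerPair (n : ℕ) (t u : Fin n ⊕ Fin n) (h : u ≠ t) :
    (Gr.msign (kerPair n u) (kerPair n t) : ℂ) = -1 * if u = t.swap then -1 else 1 := by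
  rcases t with i | i <;> rcases u with j | j <;>
  · simp only [kerPair, Sum.swap_inl, Sum.swap_inr, reduceCtorEq, if_false, Sum.inl.injEq,
      Sum.inr.injEq]
    rw [Gr.msign_pair_pair (by simp [lo, hi, xi, yi, Fin.ext_iff]; omega)
      (by simp [lo, hi, xi, yi, Fin.ext_iff]; omega)]
    simp only [lo, hi, xi, yi, Fin.lt_def, Fin.ext_iff, Fin.val_castAdd, Fin.val_natAdd, ne_eq,
      Sum.inl.injEq, Sum.inr.injEq] at h ⊢
    have := i.isLt
    have := j.isLt
    split_ifs <;> first | omega | norm_num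

theorem pow_xsq (n k : ℕ) :
    Gr.pow (xsq n) k = ∑ J ∈ Finset.powersetCard k Finset.univ,
      (k.factorial : ℂ) • Gr.monomial (J.biUnion (loHi n)) := by
  have hx : xsq n = ∑ j, (1 : ℂ) • Gr.monomial (loHi n j) := by
    simp only [one_smul]
    exact Finset.sum_congr rfl fun j _ => Gr.gen_mul_gen (by simp [lo, hi])
  rw [hx, Gr.pow_sum_monomial (loHi n) (fun t => ⟨lo n t, by simp [loHi]⟩) (loHi_disjoint n) _
    (fun _ => 1) rfl]
  · simp
  · intro t U ht
    rw [Gr.msign_biUnion_left _ _ (loHi_disjoint n), Finset.prod_eq_one, mul_one, mul_one]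
    intro u hu
    have h : (u : ℕ) ≠ t := fun h' => ht (Fin.ext h' ▸ hu)
    rw [loHi, loHi, Gr.msign_pair_pair (by simp [lo, hi]) (by simp [lo, hi])]
    simp only [lo, hi, Fin.lt_def]
    split_ifs <;> first | omega | norm_num

theorem kerCoeff_insert {n : ℕ} (c : ℂ) (t : Fin n ⊕ Fin n) (U : Finset (Fin n ⊕ Fin n))
    (ht : t ∉ U) :
    kerCoeff c (insert t U) = kerCoeff c U * Sum.elim (fun _ => c) (fun _ => -c) t *
      Gr.msign (U.biUnion (kerPair n)) (kerPair n t) := by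
  rw [Gr.msign_biUnion_left _ _ (kerPair_disjoint n),
    Finset.prod_congr rfl fun u hu => msign_kerPair n t u fun h => ht (h ▸ hu),
    Finset.prod_mul_distrib, Finset.prod_const, Finset.prod_ite_eq']
  simp only [kerCoeff, Finset.card_insert_of_notMem ht, Nat.choose_succ_succ' _ 1,
    Nat.choose_one_right]
  rcases t with i | i
  · have h1 : (insert (Sum.inl i) U).toLeft = insert i U.toLeft := by ext; simp
    have h2 : (insert (Sum.inl i) U).toRight = U.toRight := by ext; simp
    simp only [h1, h2, Sum.elim_inl]
    by_cases h : (Sum.inl i : Fin n ⊕ Fin n).swap ∈ U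
    · rw [Finset.insert_inter_of_mem (by simpa using h),
        Finset.card_insert_of_notMem (by simp [ht]), if_pos h]
      ring
    · rw [Finset.insert_inter_of_notMem (by simpa using h), if_neg h]
      ring
  · have h1 : (insert (Sum.inr i) U).toLeft = U.toLeft := by ext; simp
    have h2 : (insert (Sum.inr i) U).toRight = insert i U.toRight := by ext; simp
    simp only [h1, h2, Sum.elim_inr]
    rw [Finset.card_insert_of_notMem (s := U.toRight) (by simpa using ht)]
    by_cases h : (Sum.inr i : Fin n ⊕ Fin n).swap ∈ U
    · rw [Finset.inter_insert_of_mem (by simpa using h),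
        Finset.card_insert_of_notMem (by simp [ht]), if_pos h]
      ring
    · rw [Finset.inter_insert_of_notMem (by simpa using h), if_neg h]
      ring

theorem fermK_eq (n : ℕ) (σ : ℂ) :
    fermK n σ = ∑ U, kerCoeff (-σ * (Complex.I / 2)) U •
      Gr.monomial (U.biUnion (kerPair n)) := by
  set c := -σ * (Complex.I / 2) with hc
  have hx : (c • ∑ j : Fin n,
      (Gr.mul (Gr.gen (xi n (lo n j))) (Gr.gen (yi n (hi n j))) -
       Gr.mul (Gr.gen (xi n (hi n j))) (Gr.gen (yi n (lo n j))))) =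
      ∑ t, Sum.elim (fun _ => c) (fun _ => -c) t • (Gr.monomial (kerPair n t) : Gr ℂ _) := by
    rw [Fintype.sum_sum_type, Finset.smul_sum, ← Finset.sum_add_distrib]
    refine Finset.sum_congr rfl fun j _ => ?_
    have := j.isLt
    rw [Gr.gen_mul_gen (by simp [lo, hi, xi, yi, Fin.lt_def]; omega),
      Gr.gen_mul_gen (by simp [lo, hi, xi, yi, Fin.lt_def]; omega)]
    simp [kerPair, sub_eq_add_neg]
  rw [fermK, ← hc, hx, Gr.gexp]
  have hne : ∀ t, (kerPair n t).Nonempty := by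
    rintro (j | j)
    · exact ⟨xi n (lo n j), by simp [kerPair]⟩
    · exact ⟨xi n (hi n j), by simp [kerPair]⟩
  have key : ∀ m ∈ Finset.range (2 * n + 2 * n + 1), ((m.factorial : ℂ))⁻¹ •
      Gr.pow (∑ t, Sum.elim (fun _ => c) (fun _ => -c) t •
        (Gr.monomial (kerPair n t) : Gr ℂ _)) m =
      ∑ U with U.card = m, kerCoeff c U • Gr.monomial (U.biUnion (kerPair n)) := by
    intro m _
    rw [Gr.pow_sum_monomial _ hne (kerPair_disjoint n) _ (kerCoeff c)
      (by simp [kerCoeff, Finset.toLeft, Finset.toRight])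
      (kerCoeff_insert c), Finset.smul_sum]
    refine Finset.sum_congr (by ext; simp [Finset.mem_powersetCard]) fun U _ => ?_
    rw [smul_smul, inv_mul_cancel_left₀ (by exact_mod_cast m.factorial_ne_zero)]
  rw [Finset.sum_congr rfl key]
  refine Finset.sum_fiberwise_of_maps_to (fun U _ => ?_) _
  have := U.card_le_univ
  simp at this ⊢
  omega

theorem kerCoeff_disjSum {n : ℕ} (c : ℂ) (J : Finset (Fin n)) :
    kerCoeff c (J.disjSum J) = (-c ^ 2) ^ J.card := by
  have h : ∀ m : ℕ, (-1 : ℂ) ^ (m + m).choose 2 = (-1) ^ m := by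
    intro m
    induction m with
    | zero => simp
    | succ m ih =>
      have : (m + 1 + (m + 1)).choose 2 = (m + m).choose 2 + 1 + 2 * (m + m) := by
        rw [show m + 1 + (m + 1) = m + m + 1 + 1 by ring, Nat.choose_succ_succ' _ 1,
          Nat.choose_succ_succ' _ 1]
        simp
        ring
      rw [this, pow_add, pow_add, ih, pow_mul]
      simp [pow_succ]
  rw [kerCoeff, Finset.card_disjSum, h, Finset.toLeft_disjSum, Finset.toRight_disjSum,
    Finset.inter_self, neg_pow (c ^ 2), ← pow_mul, two_mul]
  have : ((-1 : ℂ) ^ J.card) * (-1) ^ J.card = 1 := by rw [← mul_pow]; simp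
  linear_combination (c ^ (J.card + J.card) * (-1) ^ J.card) * this

theorem xi_injective (n : ℕ) : Function.Injective (xi n) := Fin.castAdd_injective _ _

theorem yi_injective (n : ℕ) : Function.Injective (yi n) := Fin.natAdd_injective _ _

theorem embX_sum_smul_monomial {κ : Type*} (n : ℕ) (V : Finset κ) (a : κ → ℂ)
    (B : κ → Finset (Fin (2 * n))) :
    embX n (∑ j ∈ V, a j • Gr.monomial (B j)) =
      ∑ j ∈ V, a j • Gr.monomial ((B j).image (xi n)) := by
  funext T
  have key : ∀ A : Finset (Fin (2 * n)),
      (if T = A.image (xi n) then (∑ j ∈ V, a j • (Gr.monomial (B j) : Gr ℂ _)) A else 0) =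
      ∑ j ∈ V, if A = B j then (if T = (B j).image (xi n) then a j else 0) else 0 := by
    intro A
    simp only [Finset.sum_apply, Pi.smul_apply, smul_eq_mul, Gr.monomial, mul_ite, mul_one,
      mul_zero]
    rw [← Finset.sum_const_zero (s := V), ← Finset.sum_ite_irrel]
    refine Finset.sum_congr rfl fun j _ => ?_
    split_ifs <;> simp_all
  rw [embX, Finset.sum_congr rfl fun A _ => key A, Finset.sum_comm, Finset.sum_apply]
  refine Finset.sum_congr rfl fun j _ => ?_
  rw [Finset.sum_ite_eq']
  simp [Gr.monomial]

theorem berezinX_apply (n : ℕ) (F : Gr ℂ (2 * n + 2 * n)) (s : Finset (Fin (2 * n))) :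
    berezinX n F (s.image (yi n)) =
      ((Real.pi : ℂ) ^ n)⁻¹ * F (Finset.univ.image (xi n) ∪ s.image (yi n)) := by
  rw [berezinX, Pi.smul_apply, smul_eq_mul, Gr.derivList_apply]
  · congr 3
  · rw [List.pairwise_map]
    exact (List.pairwise_lt_finRange _).imp fun h => h
  · intro i hi j hj
    simp only [List.mem_map, Finset.mem_image] at hi hj
    obtain ⟨a, -, rfl⟩ := hi
    obtain ⟨b, -, rfl⟩ := hj
    simp only [xi, yi, Fin.lt_def, Fin.val_castAdd, Fin.val_natAdd]
    omega

theorem exists_lo_or_hi (n : ℕ) (t : Fin (2 * n)) : (∃ j, t = lo n j) ∨ ∃ j, t = hi n j := by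
  have := t.isLt
  rcases Nat.even_or_odd' (t : ℕ) with ⟨m, hm | hm⟩
  · exact Or.inl ⟨⟨m, by omega⟩, Fin.ext hm⟩
  · exact Or.inr ⟨⟨m, by omega⟩, Fin.ext hm⟩

theorem exists_xi_or_yi (n : ℕ) (t : Fin (2 * n + 2 * n)) :
    (∃ j, t = xi n j) ∨ ∃ j, t = yi n j := by
  induction t using Fin.addCases with
  | left i => exact Or.inl ⟨i, rfl⟩
  | right i => exact Or.inr ⟨i, rfl⟩

theorem lo_inj {n : ℕ} {i j : Fin n} : lo n i = lo n j ↔ i = j := by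
  simp [lo, Fin.ext_iff]

theorem hi_inj {n : ℕ} {i j : Fin n} : hi n i = hi n j ↔ i = j := by
  simp [hi, Fin.ext_iff]

theorem lo_ne_hi (n : ℕ) (i j : Fin n) : lo n i ≠ hi n j := by
  simp only [lo, hi, ne_eq, Fin.ext_iff]
  omega

theorem xi_ne_yi (n : ℕ) (s t : Fin (2 * n)) : xi n s ≠ yi n t := by
  simp only [xi, yi, ne_eq, Fin.ext_iff, Fin.val_castAdd, Fin.val_natAdd]
  omega

theorem lo_mem_biUnion {n : ℕ} (J : Finset (Fin n)) (i : Fin n) :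
    lo n i ∈ J.biUnion (loHi n) ↔ i ∈ J := by
  simp [loHi, lo_inj, lo_ne_hi]

theorem hi_mem_biUnion {n : ℕ} (J : Finset (Fin n)) (i : Fin n) :
    hi n i ∈ J.biUnion (loHi n) ↔ i ∈ J := by
  simp [loHi, hi_inj, (lo_ne_hi n _ _).symm]

theorem xi_lo_mem_biUnion {n : ℕ} (U : Finset (Fin n ⊕ Fin n)) (i : Fin n) :
    xi n (lo n i) ∈ U.biUnion (kerPair n) ↔ Sum.inl i ∈ U := by
  simp [kerPair, (xi_injective n).eq_iff, xi_ne_yi, lo_inj, lo_ne_hi]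

theorem xi_hi_mem_biUnion {n : ℕ} (U : Finset (Fin n ⊕ Fin n)) (i : Fin n) :
    xi n (hi n i) ∈ U.biUnion (kerPair n) ↔ Sum.inr i ∈ U := by
  simp [kerPair, (xi_injective n).eq_iff, xi_ne_yi, hi_inj, (lo_ne_hi n _ _).symm]

theorem yi_hi_mem_biUnion {n : ℕ} (U : Finset (Fin n ⊕ Fin n)) (i : Fin n) :
    yi n (hi n i) ∈ U.biUnion (kerPair n) ↔ Sum.inl i ∈ U := by
  simp [kerPair, (yi_injective n).eq_iff, (xi_ne_yi n _ _).symm, hi_inj, (lo_ne_hi n _ _).symm]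

theorem yi_lo_mem_biUnion {n : ℕ} (U : Finset (Fin n ⊕ Fin n)) (i : Fin n) :
    yi n (lo n i) ∈ U.biUnion (kerPair n) ↔ Sum.inr i ∈ U := by
  simp [kerPair, (yi_injective n).eq_iff, (xi_ne_yi n _ _).symm, lo_inj, lo_ne_hi]

theorem forall_fin_two_mul {n : ℕ} {p : Fin (2 * n) → Prop} :
    (∀ t, p t) ↔ (∀ j, p (lo n j)) ∧ ∀ j, p (hi n j) := by
  refine ⟨fun h => ⟨fun _ => h _, fun _ => h _⟩, fun h t => ?_⟩
  rcases exists_lo_or_hi n t with ⟨j, rfl⟩ | ⟨j, rfl⟩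
  exacts [h.1 j, h.2 j]

theorem forall_mixed {n : ℕ} {p : Fin (2 * n + 2 * n) → Prop} :
    (∀ t, p t) ↔ ((∀ j, p (xi n (lo n j))) ∧ ∀ j, p (xi n (hi n j))) ∧
      (∀ j, p (yi n (lo n j))) ∧ ∀ j, p (yi n (hi n j)) := by
  rw [← forall_fin_two_mul (p := fun t => p (xi n t)),
    ← forall_fin_two_mul (p := fun t => p (yi n t))]
  refine ⟨fun h => ⟨fun _ => h _, fun _ => h _⟩, fun h t => ?_⟩
  rcases exists_xi_or_yi n t with ⟨j, rfl⟩ | ⟨j, rfl⟩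
  exacts [h.1 j, h.2 j]

theorem disjoint_and_union_eq_iff {n : ℕ} (U : Finset (Fin n ⊕ Fin n)) (J : Finset (Fin n))
    (s : Finset (Fin (2 * n))) :
    (Disjoint (U.biUnion (kerPair n)) ((J.biUnion (loHi n)).image (xi n)) ∧
      Finset.univ.image (xi n) ∪ s.image (yi n) =
        U.biUnion (kerPair n) ∪ (J.biUnion (loHi n)).image (xi n)) ↔
    U = Jᶜ.disjSum Jᶜ ∧ s = Jᶜ.biUnion (loHi n) := by
  have hyx : ∀ a b, yi n a ≠ xi n b := fun a b => (xi_ne_yi n b a).symm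
  have hx : ∀ (A : Finset (Fin (2 * n))) t, xi n t ∈ A.image (xi n) ↔ t ∈ A := fun A t =>
    (xi_injective n).mem_finset_image
  have hy : ∀ (A : Finset (Fin (2 * n))) t, yi n t ∈ A.image (yi n) ↔ t ∈ A := fun A t =>
    (yi_injective n).mem_finset_image
  have hxy : ∀ (A : Finset (Fin (2 * n))) t, xi n t ∉ A.image (yi n) := fun A t => by
    simp [hyx]
  have hyx' : ∀ (A : Finset (Fin (2 * n))) t, yi n t ∉ A.image (xi n) := fun A t => by
    simp [xi_ne_yi]
  simp only [Finset.disjoint_left, Finset.ext_iff, forall_mixed, forall_fin_two_mul,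
    Finset.mem_union, hx, hy, hxy, hyx', xi_lo_mem_biUnion, xi_hi_mem_biUnion, yi_lo_mem_biUnion,
    yi_hi_mem_biUnion, lo_mem_biUnion, hi_mem_biUnion, Finset.mem_compl, Sum.forall,
    Finset.inl_mem_disjSum, Finset.inr_mem_disjSum, Finset.mem_univ, or_false, false_or, true_iff,
    not_false_eq_true, implies_true, and_true, ← forall_and]
  refine forall_congr' fun j => ?_
  tauto

theorem msign_kerPair_loHi {n : ℕ} (U : Finset (Fin n ⊕ Fin n)) (J : Finset (Fin n))
    (h : Disjoint (U.biUnion (kerPair n)) ((J.biUnion (loHi n)).image (xi n))) :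
    (Gr.msign (U.biUnion (kerPair n)) ((J.biUnion (loHi n)).image (xi n)) : ℂ) = 1 := by
  have hd : ∀ i j, i ≠ j → Disjoint ((loHi n i).image (xi n)) ((loHi n j).image (xi n)) :=
    fun i j hij => (Finset.disjoint_image (xi_injective n)).2 (loHi_disjoint n i j hij)
  rw [Finset.biUnion_image, Gr.msign_biUnion_right _ _ hd]
  refine Finset.prod_eq_one fun j hj => ?_
  rw [Gr.msign_biUnion_left _ _ (kerPair_disjoint n)]
  refine Finset.prod_eq_one fun u hu => ?_
  have h1 : Sum.inl j ∉ U := fun hU => Finset.disjoint_left.1 h ((xi_lo_mem_biUnion U j).2 hU)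
    (Finset.mem_image_of_mem _ ((lo_mem_biUnion J j).2 hj))
  have h2 : Sum.inr j ∉ U := fun hU => Finset.disjoint_left.1 h ((xi_hi_mem_biUnion U j).2 hU)
    (Finset.mem_image_of_mem _ ((hi_mem_biUnion J j).2 hj))
  have hj := j.isLt
  rw [loHi, Finset.image_insert, Finset.image_singleton]
  rcases u with i | i
  all_goals
    have hij : (i : ℕ) ≠ j := fun hij => by
      rw [Fin.ext hij] at hu
      contradiction
    rw [kerPair, Gr.msign_pair_pair (xi_ne_yi n _ _)
      (fun h => lo_ne_hi n _ _ (xi_injective n h))]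
    simp only [lo, hi, xi, yi, Fin.lt_def, Fin.val_castAdd, Fin.val_natAdd]
    split_ifs <;> first | omega | norm_num

theorem fermK_mul_embX_pow_xsq_apply (n k : ℕ) (σ : ℂ) (hσ : σ ^ 2 = 1)
    (s : Finset (Fin (2 * n))) :
    Gr.mul (fermK n σ) (embX n (Gr.pow (xsq n) k))
      (Finset.univ.image (xi n) ∪ s.image (yi n)) =
    ∑ J ∈ Finset.powersetCard k (Finset.univ : Finset (Fin n)),
      if s = Jᶜ.biUnion (loHi n) then (1 / 4 : ℂ) ^ (n - k) * k.factorial else 0 := by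
  rw [fermK_eq, pow_xsq, embX_sum_smul_monomial, Gr.mul_sum_smul, Finset.sum_comm,
    Finset.sum_apply]
  refine Finset.sum_congr rfl fun J hJ => ?_
  have key : ∀ U : Finset (Fin n ⊕ Fin n),
      ((kerCoeff (-σ * (Complex.I / 2)) U * (k.factorial : ℂ)) •
        Gr.mul (Gr.monomial (U.biUnion (kerPair n)))
          (Gr.monomial ((J.biUnion (loHi n)).image (xi n))))
        (Finset.univ.image (xi n) ∪ s.image (yi n)) =
      if U = Jᶜ.disjSum Jᶜ then
        (if s = Jᶜ.biUnion (loHi n) then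
          kerCoeff (-σ * (Complex.I / 2)) (Jᶜ.disjSum Jᶜ) * (k.factorial : ℂ) else 0) else 0 := by
    intro U
    have hiff := disjoint_and_union_eq_iff U J s
    rw [← ite_and, ← if_congr hiff rfl rfl, ite_and, Pi.smul_apply, Gr.mul_monomial]
    by_cases hd : Disjoint (U.biUnion (kerPair n)) ((J.biUnion (loHi n)).image (xi n))
    · rw [if_pos hd, if_pos hd, msign_kerPair_loHi U J hd, one_smul, Gr.monomial]
      split_ifs with he
      · rw [(hiff.1 ⟨hd, he⟩).1, smul_eq_mul, mul_one]
      · rw [smul_zero]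
    · rw [if_neg hd, if_neg hd, Pi.zero_apply, smul_zero]
  rw [Finset.sum_apply, Finset.sum_congr rfl fun U _ => key U, Finset.sum_ite_eq',
    if_pos (Finset.mem_univ _), kerCoeff_disjSum, Finset.card_compl, Fintype.card_fin,
    (Finset.mem_powersetCard.1 hJ).2]
  have : -(-σ * (Complex.I / 2)) ^ 2 = 1 / 4 := by
    linear_combination (-(Complex.I ^ 2) / 4) * hσ - 1 / 4 * Complex.I_sq
  rw [this]

/-- For every `0 ≤ k ≤ n`:
`F^±_{0|2n}(x`^{2k}) = 2^{2k-n} (k!/(n-k)!) y`^{2n-2k}`, where `x`^{2k} = (x`²)^k` with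
`x`² = Σ_{j=1}^n x`_{2j-1} x`_{2j}` and similarly in the `y` variables. -/
theorem fermFT_pow_xsq (n k : ℕ) (hk : k ≤ n) (σ : ℂ) (hσ : σ = 1 ∨ σ = -1) :
    fermFT n σ (Gr.pow (xsq n) k) =
      ((2 : ℂ) ^ (2 * k) * (k.factorial : ℂ) / ((2 : ℂ) ^ n * ((n - k).factorial : ℂ))) •
        Gr.pow (xsq n) (n - k) := by
  have hσ2 : σ ^ 2 = 1 := by rcases hσ with rfl | rfl <;> norm_num
  funext s
  rw [fermFT, berezinX_apply, fermK_mul_embX_pow_xsq_apply n k σ hσ2, pow_xsq, Pi.smul_apply,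
    Finset.sum_apply, smul_eq_mul, Finset.mul_sum, Finset.mul_sum, Finset.mul_sum]
  refine Finset.sum_bij' (fun J _ => Jᶜ) (fun J _ => Jᶜ) ?_ ?_ (fun _ _ => compl_compl _)
    (fun _ _ => compl_compl _) ?_
  · intro J hJ
    simp only [Finset.mem_powersetCard, Finset.subset_univ, true_and] at hJ ⊢
    rw [Finset.card_compl, Fintype.card_fin, hJ]
  · intro J hJ
    simp only [Finset.mem_powersetCard, Finset.subset_univ, true_and] at hJ ⊢
    rw [Finset.card_compl, Fintype.card_fin, hJ]
    omega
  · intro J _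
    rw [Pi.smul_apply, Gr.monomial, smul_eq_mul]
    split_ifs
    · have hpi : (Real.pi : ℂ) ^ n ≠ 0 := pow_ne_zero _ (by exact_mod_cast Real.pi_ne_zero)
      have hf : ((n - k).factorial : ℂ) ≠ 0 := by exact_mod_cast (n - k).factorial_ne_zero
      have h4 : (4 : ℂ) ^ n = 4 ^ (n - k) * 4 ^ k := by rw [← pow_add, Nat.sub_add_cancel hk]
      have h2 : (4 : ℂ) ^ n = 2 ^ n * 2 ^ n := by rw [← mul_pow]; norm_num
      have hk4 : (2 : ℂ) ^ (2 * k) = 4 ^ k := by rw [pow_mul]; norm_num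
      push_cast
      rw [mul_pow, hk4, one_div, inv_pow]
      field_simp
      linear_combination (k.factorial : ℂ) * (h4 - h2)
    · simp
end
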